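/- arXiv:1109.4699 — 2 statements merged into one kernel-verified Lean document; each statement's English description precedes it below -/
import Mathlib

section
/- The measure ν on ℝ × W given by dν(y,z) = (y² − ‖z‖²)^{−(m+1)/2} · 1_L(y,z) dy dz (Lebesgue measure with this density, restricted to the Lorentz cone L) is invariant under the action of G: for every (a, A) ∈ G, the pushforward of ν under the map x ↦ a • A x equals ν. -/
open scoped RealInnerProductSpace

/-- The symmetric bilinear form `Ψ((λ,w),(μ,u)) = λμ − ⟪w,u⟫` on `ℝ × W`. -/
noncomputable def Psi {m : ℕ} (x y : ℝ × EuclideanSpace ℝ (Fin m)) : ℝ :=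
  x.1 * y.1 - ⟪x.2, y.2⟫

/-- The Lorentz cone `L = {(λ,w) : λ > 0, λ² > ‖w‖²}`. -/
def LorentzCone (m : ℕ) : Set (ℝ × EuclideanSpace ℝ (Fin m)) :=
  {x | 0 < x.1 ∧ ‖x.2‖ ^ 2 < x.1 ^ 2}

/-- The pair `(a, A)` belongs to the group `G = ℝ₊₊ × SO⁺(Ψ)`. -/
noncomputable def MemG {m : ℕ} (a : ℝ)
    (A : (ℝ × EuclideanSpace ℝ (Fin m)) ≃ₗ[ℝ] (ℝ × EuclideanSpace ℝ (Fin m))) : Prop :=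
  0 < a ∧ (∀ x y, Psi (A x) (A y) = Psi x y) ∧
    LinearMap.det (A : (ℝ × EuclideanSpace ℝ (Fin m)) →ₗ[ℝ] (ℝ × EuclideanSpace ℝ (Fin m))) = 1 ∧
    0 < (A (1, 0)).1

/-- The maximal invariant statistic `π(σ₁,σ₂) = (ξ₁, ξ₂)`, the eigenvalues of `σ₂` with
respect to `σ₁`. -/
noncomputable def piStat {m : ℕ} (σ₁ σ₂ : ℝ × EuclideanSpace ℝ (Fin m)) : ℝ × ℝ :=
  ((Psi σ₁ σ₂ + Real.sqrt ((Psi σ₁ σ₂) ^ 2 - Psi σ₁ σ₁ * Psi σ₂ σ₂)) / Psi σ₁ σ₁,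
   (Psi σ₁ σ₂ - Real.sqrt ((Psi σ₁ σ₂) ^ 2 - Psi σ₁ σ₁ * Psi σ₂ σ₂)) / Psi σ₁ σ₁)


section

variable {m : ℕ}

lemma Psi_self (x : ℝ × EuclideanSpace ℝ (Fin m)) : Psi x x = x.1 ^ 2 - ‖x.2‖ ^ 2 := by
  rw [Psi, real_inner_self_eq_norm_sq, ← sq]

lemma Psi_smul_self (a : ℝ) (x : ℝ × EuclideanSpace ℝ (Fin m)) :
    Psi (a • x) (a • x) = a ^ 2 * Psi x x := by
  simp only [Psi_self, Prod.smul_fst, Prod.smul_snd, norm_smul, smul_eq_mul, mul_pow,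
    Real.norm_eq_abs, sq_abs]
  ring

lemma mem_LorentzCone_iff {x : ℝ × EuclideanSpace ℝ (Fin m)} :
    x ∈ LorentzCone m ↔ 0 < x.1 ∧ 0 < Psi x x := by
  rw [Psi_self, sub_pos]
  rfl

lemma Psi_pos_of_mem_LorentzCone {x y : ℝ × EuclideanSpace ℝ (Fin m)}
    (hx : x ∈ LorentzCone m) (hy : y ∈ LorentzCone m) : 0 < Psi x y := by
  have hx' : ‖x.2‖ < x.1 := lt_of_pow_lt_pow_left₀ 2 hx.1.le hx.2
  have hy' : ‖y.2‖ < y.1 := lt_of_pow_lt_pow_left₀ 2 hy.1.le hy.2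
  have h := mul_lt_mul'' hx' hy' (norm_nonneg _) (norm_nonneg _)
  have h' := real_inner_le_norm x.2 y.2
  unfold Psi
  linarith

/-- Among timelike vectors, the ones in the Lorentz cone are those having positive pairing with
a given vector of the cone. -/
lemma mem_LorentzCone_iff_Psi_pos {x p : ℝ × EuclideanSpace ℝ (Fin m)}
    (hp : p ∈ LorentzCone m) :
    x ∈ LorentzCone m ↔ 0 < Psi x p ∧ 0 < Psi x x := by
  refine ⟨fun hx => ⟨Psi_pos_of_mem_LorentzCone hx hp, (mem_LorentzCone_iff.1 hx).2⟩, ?_⟩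
  rintro ⟨h1, h2⟩
  refine mem_LorentzCone_iff.2 ⟨?_, h2⟩
  by_contra! hx
  have hx0 : x.1 ≠ 0 := by
    intro h0
    rw [Psi_self, h0] at h2
    nlinarith [sq_nonneg ‖x.2‖]
  have hneg : -x ∈ LorentzCone m := by
    refine mem_LorentzCone_iff.2 ⟨by simpa using lt_of_le_of_ne hx hx0, ?_⟩
    simpa [Psi] using h2
  have h3 := Psi_pos_of_mem_LorentzCone hneg hp
  have h4 : Psi (-x) p = -Psi x p := by
    simp [Psi]
    ring
  linarith

lemma one_zero_mem_LorentzCone : ((1, 0) : ℝ × EuclideanSpace ℝ (Fin m)) ∈ LorentzCone m := by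
  simp [LorentzCone]

lemma isOpen_LorentzCone : IsOpen (LorentzCone m) :=
  (isOpen_lt continuous_const continuous_fst).inter
    (isOpen_lt (continuous_snd.norm.pow 2) (continuous_fst.pow 2))

lemma apply_mem_LorentzCone_iff
    {A : (ℝ × EuclideanSpace ℝ (Fin m)) → (ℝ × EuclideanSpace ℝ (Fin m))}
    (hA : ∀ x y, Psi (A x) (A y) = Psi x y) (h0 : 0 < (A (1, 0)).1)
    (x : ℝ × EuclideanSpace ℝ (Fin m)) : A x ∈ LorentzCone m ↔ x ∈ LorentzCone m := by
  have hp : A (1, 0) ∈ LorentzCone m :=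
    mem_LorentzCone_iff.2 ⟨h0, by rw [hA]; exact (mem_LorentzCone_iff.1 one_zero_mem_LorentzCone).2⟩
  rw [mem_LorentzCone_iff_Psi_pos hp, mem_LorentzCone_iff_Psi_pos one_zero_mem_LorentzCone,
    hA, hA]

lemma smul_mem_LorentzCone_iff {a : ℝ} (ha : 0 < a) (x : ℝ × EuclideanSpace ℝ (Fin m)) :
    a • x ∈ LorentzCone m ↔ x ∈ LorentzCone m := by
  rw [mem_LorentzCone_iff, mem_LorentzCone_iff, Psi_smul_self, Prod.smul_fst, smul_eq_mul,
    mul_pos_iff_of_pos_left ha, mul_pos_iff_of_pos_left (pow_pos ha 2)]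

end

open MeasureTheory in
/-- A measure with density `f` is invariant under a linear automorphism `T` as soon as
`f = |det T| • (f ∘ T)`. -/
lemma map_withDensity_addHaar_eq_self {E : Type*} [NormedAddCommGroup E] [NormedSpace ℝ E]
    [MeasurableSpace E] [BorelSpace E] [FiniteDimensional ℝ E] (μ : Measure E)
    [μ.IsAddHaarMeasure] {T : E →ₗ[ℝ] E} (hT : LinearMap.det T ≠ 0) {f : E → ENNReal}
    (hf : Measurable f) (h : ∀ x, f x = ENNReal.ofReal |LinearMap.det T| * f (T x)) :
    Measure.map T (μ.withDensity f) = μ.withDensity f := by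
  have hTm : Measurable T := T.continuous_of_finiteDimensional.measurable
  ext s hs
  rw [Measure.map_apply hTm hs, withDensity_apply _ (hTm hs), withDensity_apply _ hs]
  calc ∫⁻ x in T ⁻¹' s, f x ∂μ
      = ENNReal.ofReal |LinearMap.det T| * ∫⁻ x in T ⁻¹' s, f (T x) ∂μ := by
        rw [← lintegral_const_mul _ (show Measurable fun x => f (T x) from hf.comp hTm)]
        exact lintegral_congr h
    _ = ENNReal.ofReal |LinearMap.det T| * ∫⁻ y in s, f y ∂(Measure.map T μ) := by
        rw [setLIntegral_map hs hf hTm]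
    _ = ∫⁻ y in s, f y ∂μ := by
        rw [Measure.map_linearMap_addHaar_eq_smul_addHaar μ hT, Measure.restrict_smul,
          lintegral_smul_measure, smul_eq_mul, ← mul_assoc,
          ← ENNReal.ofReal_mul (abs_nonneg _), ← abs_mul, mul_inv_cancel₀ hT]
        simp

open MeasureTheory in
theorem invariant_measure (m : ℕ) (hm : 1 ≤ m)
    (a : ℝ) (A : (ℝ × EuclideanSpace ℝ (Fin m)) ≃ₗ[ℝ] (ℝ × EuclideanSpace ℝ (Fin m)))
    (hG : MemG a A) :
    Measure.map (fun x => a • A x)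
        (volume.withDensity fun x =>
          Set.indicator (LorentzCone m)
            (fun x => ENNReal.ofReal ((x.1 ^ 2 - ‖x.2‖ ^ 2) ^ (-(((m : ℝ) + 1) / 2)))) x) =
      volume.withDensity fun x =>
        Set.indicator (LorentzCone m)
          (fun x => ENNReal.ofReal ((x.1 ^ 2 - ‖x.2‖ ^ 2) ^ (-(((m : ℝ) + 1) / 2)))) x := by
  obtain ⟨ha, hA, hdet, h0⟩ := hG
  set T : (ℝ × EuclideanSpace ℝ (Fin m)) →ₗ[ℝ] (ℝ × EuclideanSpace ℝ (Fin m)) :=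
    a • (A : (ℝ × EuclideanSpace ℝ (Fin m)) →ₗ[ℝ] (ℝ × EuclideanSpace ℝ (Fin m))) with hTdef
  have hT : LinearMap.det T = a ^ (m + 1) := by
    rw [hTdef, LinearMap.det_smul, hdet, mul_one]
    simp [add_comm]
  have hTpos : 0 < LinearMap.det T := hT ▸ pow_pos ha _
  have : (volume : Measure (ℝ × EuclideanSpace ℝ (Fin m))).IsAddHaarMeasure :=
    Measure.prod.instIsAddHaarMeasure volume volume
  refine map_withDensity_addHaar_eq_self volume (T := T) hTpos.ne' ?_ fun x => ?_
  · exact Measurable.indicator (by fun_prop) isOpen_LorentzCone.measurableSet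
  have hmem : T x ∈ LorentzCone m ↔ x ∈ LorentzCone m :=
    (smul_mem_LorentzCone_iff ha (A x)).trans (apply_mem_LorentzCone_iff hA h0 x)
  by_cases hx : x ∈ LorentzCone m
  · rw [Set.indicator_of_mem hx, Set.indicator_of_mem (hmem.2 hx), abs_of_pos hTpos,
      ← ENNReal.ofReal_mul hTpos.le, ← Psi_self, ← Psi_self]
    have hTx : Psi (T x) (T x) = a ^ 2 * Psi x x := by
      rw [← hA x x]
      exact Psi_smul_self a (A x)
    have hpow : (a ^ 2) ^ (-(((m : ℝ) + 1) / 2)) = (a ^ (m + 1))⁻¹ := by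
      rw [← Real.rpow_natCast a 2, ← Real.rpow_mul ha.le, ← Real.rpow_natCast a (m + 1),
        ← Real.rpow_neg ha.le]
      congr 1
      push_cast
      ring
    rw [hTx, hT, Real.mul_rpow (sq_nonneg a) (mem_LorentzCone_iff.1 hx).2.le, hpow,
      mul_inv_cancel_left₀ (pow_pos ha _).ne']
  · rw [Set.indicator_of_notMem hx, Set.indicator_of_notMem (mt hmem.1 hx), mul_zero]
end

section
/- For σ₁ = (λ, w) and σ₂ = (μ, u) in the Lorentz cone L, equality Ψ(σ₁, σ₂) = √(Ψ(σ₁,σ₁) · Ψ(σ₂,σ₂)) holds if and only if σ₂ is a positive scalar multiple of σ₁, i.e. there exists c > 0 with σ₂ = c • σ₁. -/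
open scoped RealInnerProductSpace

theorem norm_sq_smul_sub_smul_eq_Psi {m : ℕ} (x y : ℝ × EuclideanSpace ℝ (Fin m)) :
    ‖x.1 • y.2 - y.1 • x.2‖ ^ 2 =
      2 * x.1 * y.1 * Psi x y - x.1 ^ 2 * Psi y y - y.1 ^ 2 * Psi x x := by
  rw [← real_inner_self_eq_norm_sq]
  simp only [Psi, inner_sub_left, inner_sub_right, real_inner_smul_left, real_inner_smul_right,
    real_inner_comm x.2 y.2]
  ring

theorem Psi_smul_left {m : ℕ} (c : ℝ) (x y : ℝ × EuclideanSpace ℝ (Fin m)) :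
    Psi (c • x) y = c * Psi x y := by
  simp only [Psi, Prod.smul_fst, Prod.smul_snd, smul_eq_mul, real_inner_smul_left]
  ring

theorem Psi_smul_right {m : ℕ} (c : ℝ) (x y : ℝ × EuclideanSpace ℝ (Fin m)) :
    Psi x (c • y) = c * Psi x y := by
  simp only [Psi, Prod.smul_fst, Prod.smul_snd, smul_eq_mul, real_inner_smul_right]
  ring

theorem Psi_self_pos {m : ℕ} {x : ℝ × EuclideanSpace ℝ (Fin m)} (hx : x ∈ LorentzCone m) :
    0 < Psi x x := by
  have h := hx.2
  rw [Psi, real_inner_self_eq_norm_sq]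
  linarith

theorem psi_eq_sqrt_iff (m : ℕ) (hm : 1 ≤ m)
    (σ₁ σ₂ : ℝ × EuclideanSpace ℝ (Fin m))
    (h₁ : σ₁ ∈ LorentzCone m) (h₂ : σ₂ ∈ LorentzCone m) :
    Psi σ₁ σ₂ = Real.sqrt (Psi σ₁ σ₁ * Psi σ₂ σ₂) ↔ ∃ c : ℝ, 0 < c ∧ σ₂ = c • σ₁ := by
  have hQ₁ := Psi_self_pos h₁
  have hQ₂ := Psi_self_pos h₂
  have ha : 0 < σ₁.1 := h₁.1
  have hb : 0 < σ₂.1 := h₂.1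
  constructor
  · intro h
    have hP : Psi σ₁ σ₂ ^ 2 = Psi σ₁ σ₁ * Psi σ₂ σ₂ := by
      rw [h, Real.sq_sqrt (mul_pos hQ₁ hQ₂).le]
    have hmul : ‖σ₁.1 • σ₂.2 - σ₂.1 • σ₁.2‖ ^ 2 * Psi σ₂ σ₂ =
        -(σ₁.1 * Psi σ₂ σ₂ - σ₂.1 * Psi σ₁ σ₂) ^ 2 := by
      rw [norm_sq_smul_sub_smul_eq_Psi]
      linear_combination σ₂.1 ^ 2 * hP
    have hle : ‖σ₁.1 • σ₂.2 - σ₂.1 • σ₁.2‖ ^ 2 ≤ 0 := by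
      refine nonpos_of_mul_nonpos_left ?_ hQ₂
      rw [hmul]
      exact neg_nonpos.mpr (sq_nonneg _)
    have hzero : σ₁.1 • σ₂.2 = σ₂.1 • σ₁.2 :=
      sub_eq_zero.mp (norm_eq_zero.mp (pow_eq_zero_iff two_ne_zero |>.mp
        (le_antisymm hle (sq_nonneg _))))
    refine ⟨σ₂.1 / σ₁.1, div_pos hb ha, Prod.ext ?_ ?_⟩
    · simp [ha.ne']
    · rw [Prod.smul_snd, div_eq_inv_mul, mul_smul, ← hzero, inv_smul_smul₀ ha.ne']
  · rintro ⟨c, hc, rfl⟩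
    rw [Psi_smul_left, Psi_smul_right]
    rw [show Psi σ₁ σ₁ * (c * (c * Psi σ₁ σ₁)) = (c * Psi σ₁ σ₁) ^ 2 by ring,
      Real.sqrt_sq (mul_pos hc hQ₁).le]
end
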